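/- arXiv:math/0105130 — 2 statements merged into one kernel-verified Lean document; each statement's English description precedes it below -/
import Mathlib

section
/- Let (M⁴,J) be a 4-dimensional almost complex manifold and x a point such that: N_J ≠ 0 near x, so Π² = Im N_J is a rank-2 distribution; the derived differential system Π³, spanned by sections of Π² together with brackets of pairs of such sections, is a rank-3 distribution near x; and brackets of sections of Π² with sections of Π³ span the whole tangent bundle near x. Then near x there exists a frame (ξ₁,ξ₂,ξ₃,ξ₄), with (ξ₁,ξ₂) canonically determined up to simultaneous sign and (ξ₃,ξ₄) canonically determined, such that: ξ₁,ξ₂ span Π², ξ₂ = Jξ₁, ξ₃ = [ξ₁,ξ₂], ξ₄ = Jξ₃, and the Nijenhuis tensor satisfies N_J(ξ₁,ξ₂) = 0, N_J(ξ₁,ξ₃) = ξ₁, N_J(ξ₁,ξ₄) = −ξ₂, N_J(ξ₂,ξ₃) = −ξ₂, N_J(ξ₂,ξ₄) = −ξ₁, N_J(ξ₃,ξ₄) = 0. In particular this frame uniquely restores the operator J and the tensor N_J. -/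
/-!
STATEMENT 1 (Theorem 1).  On a 4-dimensional almost complex manifold (chart model
`E4 = EuclideanSpace ℝ (Fin 4)`) in general position — `N_J ≠ 0` near `x`, the derived
system `Π³ = ∂Π²` (spanned by sections of `Π² = Im N_J` and brackets of pairs of such
sections) has rank 3 near `x`, and brackets of sections of `Π²` with sections of `Π³`
span the whole tangent space — there is near `x` a canonical frame `(ξ₁,ξ₂,ξ₃,ξ₄)`,
with `(ξ₁,ξ₂)` determined up to a simultaneous sign and `(ξ₃,ξ₄)` absolutely canonical,
satisfying `span{ξ₁,ξ₂} = Π²`, `ξ₂ = Jξ₁`, `ξ₃ = [ξ₁,ξ₂]`, `ξ₄ = Jξ₃` and the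
Nijenhuis tensor table `N(ξ₁,ξ₂) = 0`, `N(ξ₁,ξ₃) = ξ₁`, `N(ξ₁,ξ₄) = −ξ₂`,
`N(ξ₂,ξ₃) = −ξ₂`, `N(ξ₂,ξ₄) = −ξ₁`, `N(ξ₃,ξ₄) = 0`; this frame uniquely restores `J`
and `N_J`.
-/

noncomputable section

abbrev E4 := EuclideanSpace ℝ (Fin 4)

/-- The Nijenhuis tensor `N_J(ξ,η)` at the point `x`. -/
def nijenhuis (J : E4 → E4 →L[ℝ] E4) (x : E4) (ξ η : E4) : E4 :=
  fderiv ℝ (fun y => J y η) x (J x ξ) - fderiv ℝ (fun y => J y ξ) x (J x η)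
    + J x (fderiv ℝ (fun y => J y ξ) x η) - J x (fderiv ℝ (fun y => J y η) x ξ)

/-- The Nijenhuis tensor characteristic distribution `Π² = Im N_J` at `x`. -/
def charDist (J : E4 → E4 →L[ℝ] E4) (x : E4) : Submodule ℝ E4 :=
  Submodule.span ℝ {v | ∃ ξ η, nijenhuis J x ξ η = v}

/-- Lie bracket of vector fields in a chart. -/
def lieB (f g : E4 → E4) (x : E4) : E4 :=
  fderiv ℝ g x (f x) - fderiv ℝ f x (g x)

/-- Smooth local sections of the distribution `P` over `U`. -/
def IsSection (U : Set E4) (P : E4 → Submodule ℝ E4) (v : E4 → E4) : Prop :=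
  ContDiffOn ℝ (⊤ : ℕ∞) v U ∧ ∀ y ∈ U, v y ∈ P y

/-- The derived differential system `Π³ = ∂Π² = Π² + [Π²,Π²]` at `y` (relative to the
neighborhood `U`). -/
def derived (J : E4 → E4 →L[ℝ] E4) (U : Set E4) (y : E4) : Submodule ℝ E4 :=
  charDist J y ⊔ Submodule.span ℝ
    {w | ∃ v₁ v₂ : E4 → E4, IsSection U (charDist J) v₁ ∧ IsSection U (charDist J) v₂ ∧
      lieB v₁ v₂ y = w}

open Set Filter Topology

section PointwiseAlgebra

variable {V : Type*} [AddCommGroup V] [Module ℝ V]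

theorem eq_zero_of_smul_add_smul_complex {J : V →ₗ[ℝ] V} (hJ : ∀ v, J (J v) = -v) {v : V}
    (hv : v ≠ 0) {a b : ℝ} (h : a • v + b • J v = 0) : a = 0 ∧ b = 0 := by
  have h1 : a • J v - b • v = 0 := by
    have := congrArg J h
    simpa [hJ, sub_eq_add_neg] using this
  have h2 : (a ^ 2 + b ^ 2) • v = 0 := by
    linear_combination (norm := module) a • h - b • h1
  have h3 := (smul_eq_zero.1 h2).resolve_right hv
  constructor <;> nlinarith [sq_nonneg a, sq_nonneg b]

theorem linearIndependent_complex_pair {J : V →ₗ[ℝ] V} (hJ : ∀ v, J (J v) = -v) {v u : V}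
    (hv : v ≠ 0) (hu : u ∉ Submodule.span ℝ {v, J v}) :
    LinearIndependent ℝ ![v, J v, u, J u] := by
  rw [Fintype.linearIndependent_iff]
  intro g hg
  simp only [Fin.sum_univ_four, Matrix.cons_val_zero, Matrix.cons_val_one, Matrix.cons_val] at hg
  have h1 : g 0 • J v - g 1 • v + g 2 • J u - g 3 • u = 0 := by
    have := congrArg J hg
    simpa [hJ, sub_eq_add_neg] using this
  have h2 : (g 2 ^ 2 + g 3 ^ 2) • u =
      (-(g 2 * g 0) - g 3 * g 1) • v + (g 3 * g 0 - g 2 * g 1) • J v := by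
    linear_combination (norm := module) g 2 • hg - g 3 • h1
  have h3 : g 2 ^ 2 + g 3 ^ 2 = 0 := by
    by_contra h
    refine hu (((Submodule.span ℝ {v, J v}).smul_mem_iff h).1 ?_)
    rw [h2]
    exact Submodule.mem_span_pair.2 ⟨_, _, rfl⟩
  have h4 : g 2 = 0 := by nlinarith [sq_nonneg (g 2), sq_nonneg (g 3)]
  have h5 : g 3 = 0 := by nlinarith [sq_nonneg (g 2), sq_nonneg (g 3)]
  rw [h4, h5] at hg
  obtain ⟨h6, h7⟩ := eq_zero_of_smul_add_smul_complex hJ hv (a := g 0) (b := g 1) (by simpa using hg)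
  intro i
  fin_cases i <;> assumption

/-- The algebraic properties shared by all Nijenhuis tensors at a point. -/
structure IsNijenhuisForm (J : V →ₗ[ℝ] V) (N : V →ₗ[ℝ] V →ₗ[ℝ] V) : Prop where
  sq : ∀ v, J (J v) = -v
  swap : ∀ a b, N a b = -N b a
  map_left : ∀ a b, N (J a) b = -J (N a b)

namespace IsNijenhuisForm

variable {J : V →ₗ[ℝ] V} {N : V →ₗ[ℝ] V →ₗ[ℝ] V}

theorem map_right (h : IsNijenhuisForm J N) (a b : V) : N a (J b) = -J (N a b) := by
  rw [h.swap, h.map_left, h.swap b a]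
  simp

theorem self (h : IsNijenhuisForm J N) (a : V) : N a a = 0 := by
  have h2 : (2 : ℝ) • N a a = 0 := by
    rw [two_smul]
    exact eq_neg_iff_add_eq_zero.1 (h.swap a a)
  exact (smul_eq_zero.1 h2).resolve_left two_ne_zero

theorem notMem_span (h : IsNijenhuisForm J N) {a b : V} (hab : N a b ≠ 0) :
    b ∉ Submodule.span ℝ {a, J a} := by
  intro hb
  obtain ⟨s, t, rfl⟩ := Submodule.mem_span_pair.1 hb
  simp [h.self, h.map_right] at hab

theorem linearIndependent (h : IsNijenhuisForm J N) {a b : V} (hab : N a b ≠ 0) :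
    LinearIndependent ℝ ![a, J a, b, J b] := by
  refine linearIndependent_complex_pair h.sq ?_ (h.notMem_span hab)
  rintro rfl
  simp at hab

theorem apply_mem (h : IsNijenhuisForm J N) (hV : Module.finrank ℝ V = 4) {a b : V}
    (hab : LinearIndependent ℝ ![a, J a, b, J b]) (c d : V) :
    N c d ∈ Submodule.span ℝ {N a b, J (N a b)} := by
  have : FiniteDimensional ℝ V := .of_finrank_pos (by omega)
  have key : ∀ z : V, ∃ s : Fin 4 → ℝ, z = s 0 • a + s 1 • J a + s 2 • b + s 3 • J b := by
    intro z
    have hz : z ∈ Submodule.span ℝ (Set.range ![a, J a, b, J b]) := by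
      rw [hab.span_eq_top_of_card_eq_finrank' (by simp [hV])]
      trivial
    obtain ⟨s, hs⟩ := (Submodule.mem_span_range_iff_exists_fun ℝ).1 hz
    exact ⟨s, by rw [← hs]; simp [Fin.sum_univ_four]⟩
  obtain ⟨s, rfl⟩ := key c
  obtain ⟨t, rfl⟩ := key d
  refine Submodule.mem_span_pair.2
    ⟨s 0 * t 2 - s 1 * t 3 - s 2 * t 0 + s 3 * t 1,
      -(s 0 * t 3) - s 1 * t 2 + s 2 * t 1 + s 3 * t 0, ?_⟩
  simp only [map_add, map_smul, LinearMap.add_apply, LinearMap.smul_apply, h.map_left,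
    h.map_right, h.self, h.swap b a, map_neg, h.sq, map_zero]
  module

theorem apply_ne_zero (h : IsNijenhuisForm J N) (hV : Module.finrank ℝ V = 4)
    (hN : ∃ c d, N c d ≠ 0) {a b : V} (ha : a ≠ 0) (hb : b ∉ Submodule.span ℝ {a, J a}) :
    N a b ≠ 0 := by
  intro h0
  obtain ⟨c, d, hcd⟩ := hN
  have := h.apply_mem hV (linearIndependent_complex_pair h.sq ha hb) c d
  rw [h0] at this
  exact hcd (by simpa using this)

theorem span_range_eq (h : IsNijenhuisForm J N) (hV : Module.finrank ℝ V = 4) {a b : V}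
    (hab : N a b ≠ 0) :
    Submodule.span ℝ {v | ∃ c d, N c d = v} = Submodule.span ℝ {N a b, J (N a b)} := by
  apply le_antisymm
  · rw [Submodule.span_le]
    rintro _ ⟨c, d, rfl⟩
    exact h.apply_mem hV (h.linearIndependent hab) c d
  · rw [Submodule.span_le]
    rintro _ (rfl | rfl)
    · exact Submodule.subset_span ⟨a, b, rfl⟩
    · exact Submodule.subset_span ⟨a, -J b, by simp [h.map_right]⟩

end IsNijenhuisForm

end PointwiseAlgebra

section PlaneCoordinate

variable {E : Type*} [NormedAddCommGroup E] [InnerProductSpace ℝ E]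

/-- The Gram determinant of two vectors. -/
def gramDet (v w : E) : ℝ := inner ℝ v v * inner ℝ w w - inner ℝ v w ^ 2

/-- The coefficient of `v` in the orthogonal projection of `z` to the plane spanned by the
independent vectors `v` and `w`. -/
def planeCoord (v w z : E) : ℝ :=
  (inner ℝ z v * inner ℝ w w - inner ℝ z w * inner ℝ v w) / gramDet v w

theorem gramDet_comm (v w : E) : gramDet v w = gramDet w v := by
  simp only [gramDet, real_inner_comm v w]
  ring

theorem gramDet_ne_zero {v w : E} (h : ∀ a b : ℝ, a • v + b • w = 0 → a = 0 ∧ b = 0) :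
    gramDet v w ≠ 0 := by
  intro hG
  have h0 : inner ℝ w w • v + (-inner ℝ v w) • w = 0 := by
    rw [← inner_self_eq_zero (𝕜 := ℝ)]
    simp only [inner_add_left, inner_add_right, real_inner_smul_left, real_inner_smul_right,
      real_inner_comm v w]
    simp only [gramDet] at hG
    linear_combination inner ℝ w w * hG
  have hw : w = 0 := inner_self_eq_zero.1 (h _ _ h0).1
  exact one_ne_zero (h 0 1 (by simp [hw])).2

theorem planeCoord_left {v w : E} (h : gramDet v w ≠ 0) (a b : ℝ) :
    planeCoord v w (a • v + b • w) = a := by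
  rw [planeCoord, div_eq_iff h]
  simp only [gramDet, inner_add_left, real_inner_smul_left, real_inner_comm v w]
  ring

theorem planeCoord_right {v w : E} (h : gramDet v w ≠ 0) (a b : ℝ) :
    planeCoord w v (a • v + b • w) = b := by
  rw [add_comm, planeCoord_left (gramDet_comm v w ▸ h)]

theorem eq_planeCoord_smul_add {v w z : E} (h : gramDet v w ≠ 0)
    (hz : z ∈ Submodule.span ℝ {v, w}) :
    z = planeCoord v w z • v + planeCoord w v z • w := by
  obtain ⟨a, b, rfl⟩ := Submodule.mem_span_pair.1 hz
  rw [planeCoord_left h, planeCoord_right h]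

theorem ContDiffOn.planeCoord {F : Type*} [NormedAddCommGroup F] [NormedSpace ℝ F]
    {n : WithTop ℕ∞} {s : Set F} {v w z : F → E} (hv : ContDiffOn ℝ n v s)
    (hw : ContDiffOn ℝ n w s) (hz : ContDiffOn ℝ n z s) (h : ∀ y ∈ s, gramDet (v y) (w y) ≠ 0) :
    ContDiffOn ℝ n (fun y => planeCoord (v y) (w y) (z y)) s := by
  unfold _root_.planeCoord
  refine ContDiffOn.div ?_ ?_ h
  · exact ((hz.inner ℝ hv).mul (hw.inner ℝ hw)).sub ((hz.inner ℝ hw).mul (hv.inner ℝ hw))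
  · unfold gramDet
    exact ((hv.inner ℝ hv).mul (hw.inner ℝ hw)).sub ((hv.inner ℝ hw).pow 2)

end PlaneCoordinate

section SquareRoot

variable {E : Type*} [NormedAddCommGroup E] [NormedSpace ℝ E]

theorem exists_contDiffOn_complex_sqrt_of_pos {n : WithTop ℕ∞} {s : Set E} (hs : IsOpen s)
    {P Q : E → ℝ} (hP : ContDiffOn ℝ n P s) (hQ : ContDiffOn ℝ n Q s) {x : E} (hx : x ∈ s)
    (h : 0 < P x ∨ Q x ≠ 0) :
    ∃ t, IsOpen t ∧ x ∈ t ∧ t ⊆ s ∧ ∃ f g : E → ℝ, ContDiffOn ℝ n f t ∧ ContDiffOn ℝ n g t ∧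
      ∀ y ∈ t, f y ^ 2 - g y ^ 2 = P y ∧ 2 * f y * g y = Q y := by
  set H : E → ℝ := fun y => √(P y ^ 2 + Q y ^ 2) + P y with hH
  have hcont : ContinuousOn H s :=
    (((hP.continuousOn.pow 2).add (hQ.continuousOn.pow 2)).sqrt).add hP.continuousOn
  have hpos : 0 < H x := by
    rcases h with h | h
    · have := Real.sqrt_nonneg (P x ^ 2 + Q x ^ 2)
      simp only [hH]; linarith
    · have : |P x| < √(P x ^ 2 + Q x ^ 2) := by
        rw [← Real.sqrt_sq_eq_abs]
        exact Real.sqrt_lt_sqrt (sq_nonneg _) (by have := sq_pos_of_ne_zero h; linarith)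
      have := (abs_lt.1 this).1
      simp only [hH]; linarith
  set t := s ∩ H ⁻¹' Ioi 0
  have hts : t ⊆ s := inter_subset_left
  have hne : ∀ y ∈ t, P y ^ 2 + Q y ^ 2 ≠ 0 := by
    intro y hy h0
    have hPy : P y = 0 := by nlinarith [sq_nonneg (P y), sq_nonneg (Q y)]
    have hHy : 0 < √(P y ^ 2 + Q y ^ 2) + P y := hy.2
    rw [h0, hPy] at hHy
    simp at hHy
  have hHt : ContDiffOn ℝ n H t :=
    ((((hP.mono hts).pow 2).add ((hQ.mono hts).pow 2)).sqrt hne).add (hP.mono hts)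
  have hf : ContDiffOn ℝ n (fun y => √(H y / 2)) t :=
    (hHt.div_const 2).sqrt fun y hy => (half_pos hy.2).ne'
  have hf0 : ∀ y ∈ t, 2 * √(H y / 2) ≠ 0 := fun y hy =>
    (mul_pos two_pos (Real.sqrt_pos.2 (half_pos hy.2))).ne'
  refine ⟨t, hcont.isOpen_inter_preimage hs isOpen_Ioi, ⟨hx, hpos⟩, hts, _,
    fun y => Q y / (2 * √(H y / 2)), hf, (hQ.mono hts).div (contDiffOn_const.mul hf) hf0, ?_⟩
  intro y hy
  have hHy : 0 < H y := hy.2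
  have h1 : √(H y / 2) ^ 2 = H y / 2 := Real.sq_sqrt (half_pos hHy).le
  have h2 : √(P y ^ 2 + Q y ^ 2) ^ 2 = P y ^ 2 + Q y ^ 2 := Real.sq_sqrt (by positivity)
  have h3 : H y = √(P y ^ 2 + Q y ^ 2) + P y := rfl
  refine ⟨?_, mul_div_cancel₀ _ (hf0 y hy)⟩
  rw [div_pow, mul_pow, h1]
  have h4 := hHy.ne'
  field_simp
  have h5 : √(P y ^ 2 + Q y ^ 2) = H y - P y := by rw [h3]; ring
  rw [h5] at h2
  linear_combination h2

theorem exists_contDiffOn_complex_sqrt {n : WithTop ℕ∞} {s : Set E} (hs : IsOpen s)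
    {P Q : E → ℝ} (hP : ContDiffOn ℝ n P s) (hQ : ContDiffOn ℝ n Q s) {x : E} (hx : x ∈ s)
    (h : P x ≠ 0 ∨ Q x ≠ 0) :
    ∃ t, IsOpen t ∧ x ∈ t ∧ t ⊆ s ∧ ∃ f g : E → ℝ, ContDiffOn ℝ n f t ∧ ContDiffOn ℝ n g t ∧
      ∀ y ∈ t, f y ^ 2 - g y ^ 2 = P y ∧ 2 * f y * g y = Q y := by
  by_cases h' : 0 < P x ∨ Q x ≠ 0
  · exact exists_contDiffOn_complex_sqrt_of_pos hs hP hQ hx h'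
  · push Not at h'
    have hPx : P x ≠ 0 := h.resolve_right (by simp [h'.2])
    obtain ⟨t, ht, hxt, hts, f, g, hf, hg, hfg⟩ :=
      exists_contDiffOn_complex_sqrt_of_pos hs hP.neg hQ.neg hx
        (Or.inl (neg_pos.2 (lt_of_le_of_ne h'.1 hPx)))
    refine ⟨t, ht, hxt, hts, fun y => -g y, f, hg.neg, hf, fun y hy => ?_⟩
    obtain ⟨h1, h2⟩ := hfg y hy
    constructor <;> linarith

end SquareRoot

section LieBracket

theorem lieB_congr {f f' g g' : E4 → E4} {y : E4} (hf : f =ᶠ[𝓝 y] f') (hg : g =ᶠ[𝓝 y] g') :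
    lieB f g y = lieB f' g' y := by
  simp only [lieB, hf.fderiv_eq, hg.fderiv_eq, hf.eq_of_nhds, hg.eq_of_nhds]

theorem lieB_neg_neg (f g : E4 → E4) (y : E4) :
    lieB (fun z => -f z) (fun z => -g z) y = lieB f g y := by
  simp [lieB, fderiv_fun_neg]

theorem exists_lieB_combination {v w : E4 → E4} {f g h k : E4 → ℝ} {y : E4}
    (hv : DifferentiableAt ℝ v y) (hw : DifferentiableAt ℝ w y) (hf : DifferentiableAt ℝ f y)
    (hg : DifferentiableAt ℝ g y) (hh : DifferentiableAt ℝ h y) (hk : DifferentiableAt ℝ k y) :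
    ∃ a b : ℝ, lieB (fun z => f z • v z + g z • w z) (fun z => h z • v z + k z • w z) y =
      (f y * k y - g y * h y) • lieB v w y + a • v y + b • w y := by
  have key : ∀ {p q : E4 → ℝ}, DifferentiableAt ℝ p y → DifferentiableAt ℝ q y → ∀ z,
      fderiv ℝ (fun z => p z • v z + q z • w z) y z =
        p y • fderiv ℝ v y z + fderiv ℝ p y z • v y
          + (q y • fderiv ℝ w y z + fderiv ℝ q y z • w y) := by
    intro p q hp hq z
    rw [fderiv_fun_add (hp.fun_smul hv) (hq.fun_smul hw), fderiv_fun_smul hp hv,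
      fderiv_fun_smul hq hw]
    simp
  set V₁ := f y • v y + g y • w y
  set V₂ := h y • v y + k y • w y
  refine ⟨fderiv ℝ h y V₁ - fderiv ℝ f y V₂, fderiv ℝ k y V₁ - fderiv ℝ g y V₂, ?_⟩
  simp only [lieB, key hh hk, key hf hg]
  change h y • fderiv ℝ v y V₁ + fderiv ℝ h y V₁ • v y
      + (k y • fderiv ℝ w y V₁ + fderiv ℝ k y V₁ • w y)
      - (f y • fderiv ℝ v y V₂ + fderiv ℝ f y V₂ • v y
      + (g y • fderiv ℝ w y V₂ + fderiv ℝ g y V₂ • w y)) = _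
  have e1 : ∀ L : E4 →L[ℝ] E4, L V₁ = f y • L (v y) + g y • L (w y) := by simp [V₁]
  have e2 : ∀ L : E4 →L[ℝ] E4, L V₂ = h y • L (v y) + k y • L (w y) := by simp [V₂]
  rw [e1 (fderiv ℝ v y), e1 (fderiv ℝ w y), e2 (fderiv ℝ v y), e2 (fderiv ℝ w y)]
  module

theorem ContDiffOn.lieB {s : Set E4} (hs : IsOpen s) {f g : E4 → E4}
    (hf : ContDiffOn ℝ (⊤ : ℕ∞) f s) (hg : ContDiffOn ℝ (⊤ : ℕ∞) g s) :
    ContDiffOn ℝ (⊤ : ℕ∞) (lieB f g) s :=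
  ((hg.fderiv_of_isOpen hs le_rfl).clm_apply hf).sub
    ((hf.fderiv_of_isOpen hs le_rfl).clm_apply hg)

end LieBracket

section Nijenhuis

variable {J : E4 → E4 →L[ℝ] E4}

theorem nijenhuis_eq_fderiv {x : E4} (hJ : DifferentiableAt ℝ J x) (ξ η : E4) :
    nijenhuis J x ξ η = fderiv ℝ J x (J x ξ) η - fderiv ℝ J x (J x η) ξ
      + J x (fderiv ℝ J x η ξ) - J x (fderiv ℝ J x ξ η) := by
  have key : ∀ a b, fderiv ℝ (fun y => J y a) x b = fderiv ℝ J x b a := by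
    intro a b
    rw [fderiv_clm_apply hJ (differentiableAt_const a)]
    simp
  simp only [nijenhuis, key]

/-- The Nijenhuis tensor at a point as a bilinear map. -/
def nijenhuisForm (J : E4 → E4 →L[ℝ] E4) (x : E4) : E4 →ₗ[ℝ] E4 →ₗ[ℝ] E4 :=
  LinearMap.mk₂ ℝ
    (fun ξ η => fderiv ℝ J x (J x ξ) η - fderiv ℝ J x (J x η) ξ
      + J x (fderiv ℝ J x η ξ) - J x (fderiv ℝ J x ξ η))
    (by intros; simp only [map_add, add_apply]; module)
    (by intros; simp only [map_smul, smul_apply]; module)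
    (by intros; simp only [map_add, add_apply]; module)
    (by intros; simp only [map_smul, smul_apply]; module)

theorem nijenhuis_eq_form (hJ : Differentiable ℝ J) (x ξ η : E4) :
    nijenhuis J x ξ η = nijenhuisForm J x ξ η :=
  nijenhuis_eq_fderiv (hJ x) ξ η

theorem complex_apply_apply (hJ2 : ∀ x, (J x).comp (J x) = - ContinuousLinearMap.id ℝ E4)
    (x v : E4) : J x (J x v) = -v := by
  simpa using congrArg (fun L : E4 →L[ℝ] E4 => L v) (hJ2 x)

theorem fderiv_complex_apply (hJ : Differentiable ℝ J)
    (hJ2 : ∀ x, (J x).comp (J x) = - ContinuousLinearMap.id ℝ E4) (x a b : E4) :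
    fderiv ℝ J x a (J x b) = -J x (fderiv ℝ J x a b) := by
  have h0 : (fun y => J y (J y b)) = fun _ => -b := funext fun y => complex_apply_apply hJ2 y b
  have hb : DifferentiableAt ℝ (fun y => J y b) x := (hJ x).clm_apply (differentiableAt_const b)
  have h1 : fderiv ℝ (fun y => J y (J y b)) x a = 0 := by simp [h0]
  rw [fderiv_clm_apply (hJ x) hb, fderiv_clm_apply (hJ x) (differentiableAt_const b)] at h1
  simp at h1
  exact eq_neg_of_add_eq_zero_right h1

theorem isNijenhuisForm (hJ : Differentiable ℝ J)
    (hJ2 : ∀ x, (J x).comp (J x) = - ContinuousLinearMap.id ℝ E4) (x : E4) :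
    IsNijenhuisForm (J x : E4 →ₗ[ℝ] E4) (nijenhuisForm J x) where
  sq := complex_apply_apply hJ2 x
  swap a b := by
    simp only [nijenhuisForm, LinearMap.mk₂_apply]
    module
  map_left a b := by
    simp only [nijenhuisForm, LinearMap.mk₂_apply, ContinuousLinearMap.coe_coe,
      complex_apply_apply hJ2, fderiv_complex_apply hJ hJ2, map_add, map_sub, map_neg,
      neg_apply]
    module

theorem charDist_eq_span (hJ : Differentiable ℝ J)
    (hJ2 : ∀ x, (J x).comp (J x) = - ContinuousLinearMap.id ℝ E4) {x a b : E4}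
    (hab : nijenhuis J x a b ≠ 0) :
    charDist J x = Submodule.span ℝ {nijenhuis J x a b, J x (nijenhuis J x a b)} := by
  simp only [charDist, nijenhuis_eq_form hJ] at hab ⊢
  exact (isNijenhuisForm hJ hJ2 x).span_range_eq finrank_euclideanSpace_fin hab

theorem ContDiff.nijenhuis (hJ : ContDiff ℝ (⊤ : ℕ∞) J) {v w : E4 → E4} {s : Set E4}
    (hv : ContDiffOn ℝ (⊤ : ℕ∞) v s) (hw : ContDiffOn ℝ (⊤ : ℕ∞) w s) :
    ContDiffOn ℝ (⊤ : ℕ∞) (fun y => nijenhuis J y (v y) (w y)) s := by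
  have hd : Differentiable ℝ J := hJ.differentiable (by simp)
  have hD : ContDiffOn ℝ (⊤ : ℕ∞) (fderiv ℝ J) s := (hJ.fderiv_right le_rfl).contDiffOn
  have hJs := hJ.contDiffOn (s := s)
  simp only [nijenhuis_eq_fderiv (hd _)]
  exact ((((hD.clm_apply (hJs.clm_apply hv)).clm_apply hw).sub
    ((hD.clm_apply (hJs.clm_apply hw)).clm_apply hv)).add
    (hJs.clm_apply ((hD.clm_apply hw).clm_apply hv))).sub
    (hJs.clm_apply ((hD.clm_apply hv).clm_apply hw))

theorem gramDet_complex_ne_zero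
    (hJ2 : ∀ x, (J x).comp (J x) = - ContinuousLinearMap.id ℝ E4) (x : E4) {v : E4}
    (hv : v ≠ 0) : gramDet v (J x v) ≠ 0 :=
  gramDet_ne_zero fun _ _ h =>
    eq_zero_of_smul_add_smul_complex (J := (J x : E4 →ₗ[ℝ] E4)) (complex_apply_apply hJ2 x) hv h

/-- If the characteristic distribution is framed by `v, w` on `U'` and its derived system has
rank three, then `[v, w]` is transversal to it. -/
theorem lieB_notMem_charDist {U U' : Set E4} (hU' : IsOpen U') (hUU : U' ⊆ U)
    {v w : E4 → E4} (hv : ContDiffOn ℝ (⊤ : ℕ∞) v U') (hw : ContDiffOn ℝ (⊤ : ℕ∞) w U')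
    (hG : ∀ y ∈ U', gramDet (v y) (w y) ≠ 0)
    (hspan : ∀ y ∈ U', charDist J y = Submodule.span ℝ {v y, w y})
    {y : E4} (hy : y ∈ U') (h3 : Module.finrank ℝ (derived J U y) = 3) :
    lieB v w y ∉ charDist J y := by
  intro hmem
  have hG' : ∀ y ∈ U', gramDet (w y) (v y) ≠ 0 := fun y hy => gramDet_comm (v y) (w y) ▸ hG y hy
  have hnhds : U' ∈ 𝓝 y := hU'.mem_nhds hy
  have hdiff : ∀ {F : Type} [NormedAddCommGroup F] [NormedSpace ℝ F] {f : E4 → F},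
      ContDiffOn ℝ (⊤ : ℕ∞) f U' → DifferentiableAt ℝ f y := fun hf =>
    (hf.contDiffAt hnhds).differentiableAt (by simp)
  have hv_mem : v y ∈ charDist J y := by
    rw [hspan y hy]; exact Submodule.subset_span (by simp)
  have hw_mem : w y ∈ charDist J y := by
    rw [hspan y hy]; exact Submodule.subset_span (by simp)
  have hle : derived J U y ≤ charDist J y := by
    refine sup_le le_rfl (Submodule.span_le.2 ?_)
    rintro _ ⟨v₁, v₂, ⟨hs₁, hm₁⟩, ⟨hs₂, hm₂⟩, rfl⟩
    have hs₁' := hs₁.mono hUU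
    have hs₂' := hs₂.mono hUU
    have e₁ : v₁ =ᶠ[𝓝 y] fun z =>
        planeCoord (v z) (w z) (v₁ z) • v z + planeCoord (w z) (v z) (v₁ z) • w z := by
      filter_upwards [hnhds] with z hz
      exact eq_planeCoord_smul_add (hG z hz) (hspan z hz ▸ hm₁ z (hUU hz))
    have e₂ : v₂ =ᶠ[𝓝 y] fun z =>
        planeCoord (v z) (w z) (v₂ z) • v z + planeCoord (w z) (v z) (v₂ z) • w z := by
      filter_upwards [hnhds] with z hz
      exact eq_planeCoord_smul_add (hG z hz) (hspan z hz ▸ hm₂ z (hUU hz))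
    obtain ⟨a, b, hab⟩ := exists_lieB_combination (hdiff hv) (hdiff hw)
      (hdiff (hv.planeCoord hw hs₁' hG)) (hdiff (hw.planeCoord hv hs₁' hG'))
      (hdiff (hv.planeCoord hw hs₂' hG)) (hdiff (hw.planeCoord hv hs₂' hG'))
    rw [SetLike.mem_coe, lieB_congr e₁ e₂, hab]
    exact add_mem (add_mem (Submodule.smul_mem _ _ hmem) (Submodule.smul_mem _ _ hv_mem))
      (Submodule.smul_mem _ _ hw_mem)
  have h2 : Module.finrank ℝ (charDist J y) ≤ 2 := by
    rw [hspan y hy]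
    refine (finrank_span_le_card _).trans ?_
    simpa using Finset.card_le_two
  have := Submodule.finrank_mono hle
  omega

/-- Near a point in general position there is a section `ξ` of the characteristic distribution
with `N_J(ξ, [ξ, Jξ]) = ξ`. -/
theorem exists_normalized_section (hJ : ContDiff ℝ (⊤ : ℕ∞) J)
    (hJ2 : ∀ x, (J x).comp (J x) = - ContinuousLinearMap.id ℝ E4)
    {x : E4} {U : Set E4} (hU : IsOpen U) (hxU : x ∈ U)
    (hN : ∃ a b, nijenhuis J x a b ≠ 0)
    (h3 : ∀ y ∈ U, Module.finrank ℝ (derived J U y) = 3) :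
    ∃ U', IsOpen U' ∧ x ∈ U' ∧ U' ⊆ U ∧ IsPreconnected U' ∧ ∃ ξ : E4 → E4,
      ContDiffOn ℝ (⊤ : ℕ∞) ξ U' ∧ ∀ y ∈ U', ξ y ≠ 0 ∧
        nijenhuis J y (ξ y) (lieB ξ (fun z => J z (ξ z)) y) = ξ y := by
  have hJd : Differentiable ℝ J := hJ.differentiable (by simp)
  obtain ⟨a, b, hab⟩ := hN
  set v : E4 → E4 := fun y => nijenhuis J y a b
  have hv : ContDiffOn ℝ (⊤ : ℕ∞) v univ := hJ.nijenhuis contDiffOn_const contDiffOn_const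
  set w : E4 → E4 := fun y => J y (v y) with hw_def
  set u : E4 → E4 := lieB v w with hu_def
  set B : Set E4 := U ∩ {y | v y ≠ 0}
  have hB : IsOpen B :=
    hU.inter (isOpen_ne_fun (continuousOn_univ.1 hv.continuousOn) continuous_const)
  have hxB : x ∈ B := ⟨hxU, hab⟩
  have hBU : B ⊆ U := inter_subset_left
  replace hv : ContDiffOn ℝ (⊤ : ℕ∞) v B := hv.mono (subset_univ _)
  have hw : ContDiffOn ℝ (⊤ : ℕ∞) w B := hJ.contDiffOn.clm_apply hv
  have hu : ContDiffOn ℝ (⊤ : ℕ∞) u B := hv.lieB hB hw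
  have hG : ∀ y ∈ B, gramDet (v y) (w y) ≠ 0 := fun y hy => gramDet_complex_ne_zero hJ2 y hy.2
  have hG' : ∀ y ∈ B, gramDet (w y) (v y) ≠ 0 := fun y hy => gramDet_comm (v y) (w y) ▸ hG y hy
  have hspan : ∀ y ∈ B, charDist J y = Submodule.span ℝ {v y, w y} := fun y hy =>
    charDist_eq_span hJd hJ2 hy.2
  have hZ : ContDiffOn ℝ (⊤ : ℕ∞) (fun y => nijenhuis J y (v y) (u y)) B := hJ.nijenhuis hv hu
  have hZ0 : ∀ y ∈ B, nijenhuis J y (v y) (u y) ≠ 0 := by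
    intro y hy
    have hmem := lieB_notMem_charDist hB hBU hv hw hG hspan hy (h3 y (hBU hy))
    rw [hspan y hy] at hmem
    rw [nijenhuis_eq_form hJd]
    exact (isNijenhuisForm hJd hJ2 y).apply_ne_zero finrank_euclideanSpace_fin
      ⟨a, b, by rw [← nijenhuis_eq_form hJd]; exact hy.2⟩ hy.2 hmem
  set p : E4 → ℝ := fun y => planeCoord (v y) (w y) (nijenhuis J y (v y) (u y))
  set q : E4 → ℝ := fun y => planeCoord (w y) (v y) (nijenhuis J y (v y) (u y))
  have hp : ContDiffOn ℝ (⊤ : ℕ∞) p B := hv.planeCoord hw hZ hG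
  have hq : ContDiffOn ℝ (⊤ : ℕ∞) q B := hw.planeCoord hv hZ hG'
  have hpq : ∀ y ∈ B, nijenhuis J y (v y) (u y) = p y • v y + q y • w y := fun y hy =>
    eq_planeCoord_smul_add (hG y hy) (hspan y hy ▸ Submodule.subset_span ⟨_, _, rfl⟩)
  have hpq0 : ∀ y ∈ B, p y ^ 2 + q y ^ 2 ≠ 0 := by
    intro y hy h0
    have h1 : p y = 0 := by nlinarith [sq_nonneg (p y), sq_nonneg (q y)]
    have h2 : q y = 0 := by nlinarith [sq_nonneg (p y), sq_nonneg (q y)]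
    exact hZ0 y hy (by rw [hpq y hy, h1, h2]; simp)
  have hr := (hp.pow 2).add (hq.pow 2)
  obtain ⟨t, ht, hxt, htB, f, g, hf, hg, hfg⟩ := exists_contDiffOn_complex_sqrt hB
    (hp.div hr hpq0) (hq.div hr hpq0) hxB (by
      by_contra! h0
      obtain ⟨h1, h2⟩ := h0
      rw [Pi.div_apply, div_eq_zero_iff, or_iff_left (hpq0 x hxB)] at h1 h2
      exact hpq0 x hxB (by simp [h1, h2]))
  obtain ⟨ε, hε, hball⟩ := Metric.isOpen_iff.1 ht x hxt
  refine ⟨Metric.ball x ε, Metric.isOpen_ball, Metric.mem_ball_self hε,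
    hball.trans (htB.trans hBU), (convex_ball x ε).isPreconnected,
    fun y => f y • v y + g y • w y,
    ((hf.smul (hv.mono htB)).add (hg.smul (hw.mono htB))).mono hball, fun y hy => ?_⟩
  replace hy := hball hy
  have hyB := htB hy
  obtain ⟨e1, e2⟩ := hfg y hy
  have hs := hpq0 y hyB
  have e1' : (f y ^ 2 - g y ^ 2) * (p y ^ 2 + q y ^ 2) = p y := (eq_div_iff hs).1 e1
  have e2' : 2 * f y * g y * (p y ^ 2 + q y ^ 2) = q y := (eq_div_iff hs).1 e2
  have hr1 : (f y ^ 2 + g y ^ 2) ^ 2 * (p y ^ 2 + q y ^ 2) = 1 := by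
    apply mul_right_cancel₀ hs
    linear_combination ((f y ^ 2 - g y ^ 2) * (p y ^ 2 + q y ^ 2) + p y) * e1'
      + (2 * f y * g y * (p y ^ 2 + q y ^ 2) + q y) * e2'
  have hdiff : ∀ {F : Type} [NormedAddCommGroup F] [NormedSpace ℝ F] {k : E4 → F},
      ContDiffOn ℝ (⊤ : ℕ∞) k t → DifferentiableAt ℝ k y := fun hk =>
    (hk.contDiffAt (ht.mem_nhds hy)).differentiableAt (by simp)
  have hJξ : (fun z => J z (f z • v z + g z • w z)) = fun z => (-g z) • v z + f z • w z := by
    funext z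
    simp only [hw_def, map_add, map_smul, complex_apply_apply hJ2]
    module
  constructor
  · intro h0
    obtain ⟨h1, h2⟩ := eq_zero_of_smul_add_smul_complex (J := (J y : E4 →ₗ[ℝ] E4))
      (complex_apply_apply hJ2 y) hyB.2 h0
    simp [h1, h2] at hr1
  · obtain ⟨α, β, hL⟩ := exists_lieB_combination (hdiff (hv.mono htB)) (hdiff (hw.mono htB))
      (hdiff hf) (hdiff hg) (hdiff hg.neg) (hdiff hf)
    have hform := isNijenhuisForm hJd hJ2 y
    have hvu := hpq y hyB
    rw [nijenhuis_eq_form hJd] at hvu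
    have hwu : nijenhuisForm J y (w y) (u y) = q y • v y - p y • w y := by
      have := hform.map_left (v y) (u y)
      rw [hvu] at this
      refine this.trans ?_
      simp only [hw_def, ContinuousLinearMap.coe_coe, map_add, map_smul, complex_apply_apply hJ2]
      module
    have hvw : nijenhuisForm J y (v y) (w y) = 0 := by
      refine (hform.map_right (v y) (v y)).trans ?_
      rw [hform.self]
      simp
    have hwv : nijenhuisForm J y (w y) (v y) = 0 := by rw [hform.swap, hvw, neg_zero]
    rw [hJξ, hL, nijenhuis_eq_form hJd]
    simp only [map_add, map_smul, LinearMap.add_apply, LinearMap.smul_apply, ← hu_def, hvu, hwu,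
      hvw, hwv, hform.self]
    have c1 : (f y ^ 2 + g y ^ 2) * (f y * p y + g y * q y) = f y := by
      linear_combination -(f y ^ 2 + g y ^ 2) * f y * e1' - (f y ^ 2 + g y ^ 2) * g y * e2'
        + f y * hr1
    have c2 : (f y ^ 2 + g y ^ 2) * (f y * q y - g y * p y) = g y := by
      linear_combination -(f y ^ 2 + g y ^ 2) * f y * e2' + (f y ^ 2 + g y ^ 2) * g y * e1'
        + g y * hr1
    linear_combination (norm := module) c1 • v y + c2 • w y

/-- A section `η` of the characteristic distribution with `N_J(η, [η, Jη]) = η` is unique up to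
sign. -/
theorem normalized_section_unique (hJ : ContDiff ℝ (⊤ : ℕ∞) J)
    (hJ2 : ∀ x, (J x).comp (J x) = - ContinuousLinearMap.id ℝ E4)
    {U' : Set E4} (hU' : IsOpen U') (hconn : IsPreconnected U') {ξ η : E4 → E4}
    (hξ : ContDiffOn ℝ (⊤ : ℕ∞) ξ U') (hη : ContDiffOn ℝ (⊤ : ℕ∞) η U')
    (hξ0 : ∀ y ∈ U', ξ y ≠ 0) (hη0 : ∀ y ∈ U', η y ≠ 0)
    (hspan : ∀ y ∈ U', η y ∈ Submodule.span ℝ {ξ y, J y (ξ y)})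
    (hξN : ∀ y ∈ U', nijenhuis J y (ξ y) (lieB ξ (fun z => J z (ξ z)) y) = ξ y)
    (hηN : ∀ y ∈ U', nijenhuis J y (η y) (lieB η (fun z => J z (η z)) y) = η y) :
    EqOn η ξ U' ∨ EqOn η (-ξ) U' := by
  have hJd : Differentiable ℝ J := hJ.differentiable (by simp)
  set w : E4 → E4 := fun y => J y (ξ y) with hw_def
  have hw : ContDiffOn ℝ (⊤ : ℕ∞) w U' := hJ.contDiffOn.clm_apply hξ
  have hG : ∀ y ∈ U', gramDet (ξ y) (w y) ≠ 0 := fun y hy =>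
    gramDet_complex_ne_zero hJ2 y (hξ0 y hy)
  have hG' : ∀ y ∈ U', gramDet (w y) (ξ y) ≠ 0 := fun y hy =>
    gramDet_comm (ξ y) (w y) ▸ hG y hy
  set f : E4 → ℝ := fun y => planeCoord (ξ y) (w y) (η y)
  set g : E4 → ℝ := fun y => planeCoord (w y) (ξ y) (η y)
  have hf : ContDiffOn ℝ (⊤ : ℕ∞) f U' := hξ.planeCoord hw hη hG
  have hg : ContDiffOn ℝ (⊤ : ℕ∞) g U' := hw.planeCoord hξ hη hG'
  have hη_eq : ∀ y ∈ U', η y = f y • ξ y + g y • w y := fun y hy =>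
    eq_planeCoord_smul_add (hG y hy) (hspan y hy)
  have hfg : ∀ y ∈ U', f y ^ 2 = 1 ∧ g y = 0 := by
    intro y hy
    have hnhds := hU'.mem_nhds hy
    have hdiff : ∀ {F : Type} [NormedAddCommGroup F] [NormedSpace ℝ F] {k : E4 → F},
        ContDiffOn ℝ (⊤ : ℕ∞) k U' → DifferentiableAt ℝ k y := fun hk =>
      (hk.contDiffAt hnhds).differentiableAt (by simp)
    have e1 : η =ᶠ[𝓝 y] fun z => f z • ξ z + g z • w z := by
      filter_upwards [hnhds] with z hz using hη_eq z hz
    have e2 : (fun z => J z (η z)) =ᶠ[𝓝 y] fun z => (-g z) • ξ z + f z • w z := by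
      filter_upwards [hnhds] with z hz
      simp only [hη_eq z hz, hw_def, map_add, map_smul, complex_apply_apply hJ2]
      module
    obtain ⟨α, β, hL⟩ := exists_lieB_combination (hdiff hξ) (hdiff hw) (hdiff hf) (hdiff hg)
      (hdiff hg.neg) (hdiff hf)
    have hform := isNijenhuisForm hJd hJ2 y
    have hvu := hξN y hy
    rw [nijenhuis_eq_form hJd] at hvu
    have hwu : nijenhuisForm J y (w y) (lieB ξ w y) = -w y := by
      have := hform.map_left (ξ y) (lieB ξ w y)
      rw [hvu] at this
      exact this
    have hvw : nijenhuisForm J y (ξ y) (w y) = 0 := by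
      refine (hform.map_right (ξ y) (ξ y)).trans ?_
      rw [hform.self]
      simp
    have hwv : nijenhuisForm J y (w y) (ξ y) = 0 := by rw [hform.swap, hvw, neg_zero]
    have hN := hηN y hy
    rw [lieB_congr e1 e2, hL, nijenhuis_eq_form hJd, hη_eq y hy] at hN
    simp only [map_add, map_smul, LinearMap.add_apply, LinearMap.smul_apply, hvu, hwu,
      hvw, hwv, hform.self] at hN
    have hcoef : ((f y ^ 2 + g y ^ 2) * f y - f y) • ξ y
        + (-((f y ^ 2 + g y ^ 2) * g y) - g y) • w y = 0 := by
      linear_combination (norm := module) hN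
    obtain ⟨h1, h2⟩ := eq_zero_of_smul_add_smul_complex (J := (J y : E4 →ₗ[ℝ] E4))
      (complex_apply_apply hJ2 y) (hξ0 y hy) hcoef
    have hg0 : g y = 0 := by
      have h4 : g y * (f y ^ 2 + g y ^ 2 + 1) = 0 := by linear_combination -h2
      exact (mul_eq_zero.1 h4).resolve_right (by positivity)
    have hf0 : f y ≠ 0 := fun h0 => hη0 y hy (by rw [hη_eq y hy, h0, hg0]; simp)
    refine ⟨mul_right_cancel₀ hf0 ?_, hg0⟩
    rw [hg0] at h1
    linear_combination h1
  have hsq : EqOn (f ^ 2) 1 U' := fun y hy => (hfg y hy).1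
  refine (hconn.eq_one_or_eq_neg_one_of_sq_eq hf.continuousOn hsq).imp ?_ ?_ <;>
  · intro h y hy
    rw [hη_eq y hy, (hfg y hy).2, h hy]
    simp

end Nijenhuis

theorem statement1
    (J : E4 → E4 →L[ℝ] E4)
    (hJ : ContDiff ℝ (⊤ : ℕ∞) J)
    (hJ2 : ∀ x, (J x).comp (J x) = - ContinuousLinearMap.id ℝ E4)
    (x : E4) (U : Set E4) (hU : IsOpen U) (hxU : x ∈ U)
    -- general position near `x`:
    -- (i) `N_J ≠ 0`, so `Π²` is a rank-2 distribution:
    (hN : ∀ y ∈ U, ∃ ξ η, nijenhuis J y ξ η ≠ 0)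
    -- (ii) the derived system `Π³` is a rank-3 distribution:
    (h3 : ∀ y ∈ U, Module.finrank ℝ (derived J U y) = 3)
    -- (iii) brackets of sections of `Π²` with sections of `Π³` span everything:
    (h4 : ∀ y ∈ U, derived J U y ⊔ Submodule.span ℝ
        {w | ∃ v₁ v₂ : E4 → E4, IsSection U (charDist J) v₁ ∧ IsSection U (derived J U) v₂ ∧
          lieB v₁ v₂ y = w} = ⊤) :
    -- conclusion: a canonical frame near `x`:
    ∃ (U' : Set E4), IsOpen U' ∧ x ∈ U' ∧ U' ⊆ U ∧
    ∃ ξ₁ ξ₂ ξ₃ ξ₄ : E4 → E4,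
      ContDiffOn ℝ (⊤ : ℕ∞) ξ₁ U' ∧ ContDiffOn ℝ (⊤ : ℕ∞) ξ₂ U' ∧
      ContDiffOn ℝ (⊤ : ℕ∞) ξ₃ U' ∧ ContDiffOn ℝ (⊤ : ℕ∞) ξ₄ U' ∧
      (∀ y ∈ U',
        Submodule.span ℝ {ξ₁ y, ξ₂ y} = charDist J y ∧
        ξ₂ y = J y (ξ₁ y) ∧
        ξ₃ y = lieB ξ₁ ξ₂ y ∧
        ξ₄ y = J y (ξ₃ y) ∧
        -- the frame is a frame:
        LinearIndependent ℝ ![ξ₁ y, ξ₂ y, ξ₃ y, ξ₄ y] ∧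
        -- the Nijenhuis tensor table:
        nijenhuis J y (ξ₁ y) (ξ₂ y) = 0 ∧
        nijenhuis J y (ξ₁ y) (ξ₃ y) = ξ₁ y ∧
        nijenhuis J y (ξ₁ y) (ξ₄ y) = - ξ₂ y ∧
        nijenhuis J y (ξ₂ y) (ξ₃ y) = - ξ₂ y ∧
        nijenhuis J y (ξ₂ y) (ξ₄ y) = - ξ₁ y ∧
        nijenhuis J y (ξ₃ y) (ξ₄ y) = 0) ∧
      -- canonicity: `(ξ₁,ξ₂)` is determined up to a simultaneous sign and `(ξ₃,ξ₄)`
      -- absolutely: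
      (∀ η₁ η₂ η₃ η₄ : E4 → E4,
        ContDiffOn ℝ (⊤ : ℕ∞) η₁ U' → ContDiffOn ℝ (⊤ : ℕ∞) η₂ U' →
        (∀ y ∈ U',
          Submodule.span ℝ {η₁ y, η₂ y} = charDist J y ∧
          η₂ y = J y (η₁ y) ∧
          η₃ y = lieB η₁ η₂ y ∧
          η₄ y = J y (η₃ y) ∧
          nijenhuis J y (η₁ y) (η₃ y) = η₁ y ∧
          nijenhuis J y (η₂ y) (η₃ y) = - η₂ y) →
        ((∀ y ∈ U', η₁ y = ξ₁ y ∧ η₂ y = ξ₂ y) ∨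
         (∀ y ∈ U', η₁ y = - ξ₁ y ∧ η₂ y = - ξ₂ y)) ∧
        (∀ y ∈ U', η₃ y = ξ₃ y ∧ η₄ y = ξ₄ y)) := by
  have hJd : Differentiable ℝ J := hJ.differentiable (by simp)
  obtain ⟨U', hU', hxU', hUU, hconn, ξ, hξ, hξN⟩ :=
    exists_normalized_section hJ hJ2 hU hxU (hN x hxU) h3
  have hJξ : ContDiffOn ℝ (⊤ : ℕ∞) (fun y => J y (ξ y)) U' := hJ.contDiffOn.clm_apply hξ
  have hξ₃ := hξ.lieB hU' hJξ
  have hspan : ∀ y ∈ U', Submodule.span ℝ {ξ y, J y (ξ y)} = charDist J y := by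
    intro y hy
    obtain ⟨h0, h1⟩ := hξN y hy
    have := charDist_eq_span hJd hJ2 (x := y) (h1.trans_ne h0)
    rw [this, h1]
  refine ⟨U', hU', hxU', hUU, ξ, fun y => J y (ξ y), lieB ξ (fun y => J y (ξ y)),
    fun y => J y (lieB ξ (fun y => J y (ξ y)) y), hξ, hJξ, hξ₃, hJ.contDiffOn.clm_apply hξ₃,
    fun y hy => ?_, fun η₁ η₂ η₃ η₄ hη₁ hη₂ hη => ?_⟩
  · obtain ⟨h0, h1⟩ := hξN y hy
    have hform := isNijenhuisForm hJd hJ2 y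
    have hsq := complex_apply_apply hJ2 y
    simp only [nijenhuis_eq_form hJd] at h1 ⊢
    have hl : ∀ a b, nijenhuisForm J y (J y a) b = -J y (nijenhuisForm J y a b) := hform.map_left
    have hr : ∀ a b, nijenhuisForm J y a (J y b) = -J y (nijenhuisForm J y a b) := hform.map_right
    refine ⟨hspan y hy, trivial, trivial, trivial, hform.linearIndependent (h1.trans_ne h0), ?_, h1, ?_, ?_,
      ?_, ?_⟩
    · simp [hr, hform.self]
    · rw [hr, h1]
    · rw [hl, h1]
    · rw [hl, hr, h1, map_neg, hsq]
      simp
    · simp [hr, hform.self]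
  · have hη₂_eq : ∀ y ∈ U', η₂ =ᶠ[𝓝 y] fun z => J z (η₁ z) := fun y hy => by
      filter_upwards [hU'.mem_nhds hy] with z hz using (hη z hz).2.1
    have hη0 : ∀ y ∈ U', η₁ y ≠ 0 := by
      intro y hy h0
      obtain ⟨h1, h2, -⟩ := hη y hy
      have h3 : ξ y ∈ Submodule.span ℝ {η₁ y, η₂ y} := by
        rw [h1, ← hspan y hy]
        exact Submodule.subset_span (by simp)
      rw [h2, h0] at h3
      exact (hξN y hy).1 (by simpa using h3)
    have hη_span : ∀ y ∈ U', η₁ y ∈ Submodule.span ℝ {ξ y, J y (ξ y)} := by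
      intro y hy
      rw [hspan y hy, ← (hη y hy).1]
      exact Submodule.subset_span (by simp)
    have hηN : ∀ y ∈ U', nijenhuis J y (η₁ y) (lieB η₁ (fun z => J z (η₁ z)) y) = η₁ y := by
      intro y hy
      obtain ⟨-, -, h3, -, h5, -⟩ := hη y hy
      rwa [h3, lieB_congr .rfl (hη₂_eq y hy)] at h5
    have hcase := normalized_section_unique hJ hJ2 hU' hconn hξ hη₁ (fun y hy => (hξN y hy).1) hη0
      hη_span (fun y hy => (hξN y hy).2) hηN
    constructor
    · refine hcase.imp (fun h y hy => ?_) (fun h y hy => ?_)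
      · rw [(hη y hy).2.1, h hy]
        exact ⟨rfl, rfl⟩
      · rw [(hη y hy).2.1, h hy]
        exact ⟨rfl, by simp⟩
    · intro y hy
      obtain ⟨-, -, h3, h4, -⟩ := hη y hy
      suffices hL : η₃ y = lieB ξ (fun z => J z (ξ z)) y from ⟨hL, by rw [h4, hL]⟩
      rw [h3, lieB_congr .rfl (hη₂_eq y hy)]
      rcases hcase with h | h
      · have e : η₁ =ᶠ[𝓝 y] ξ := h.eventuallyEq_of_mem (hU'.mem_nhds hy)
        refine lieB_congr e ?_
        filter_upwards [e] with z hz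
        rw [hz]
      · have e : η₁ =ᶠ[𝓝 y] fun z => -ξ z := h.eventuallyEq_of_mem (hU'.mem_nhds hy)
        rw [← lieB_neg_neg ξ]
        refine lieB_congr e ?_
        filter_upwards [e] with z hz
        rw [hz, map_neg]
end
end

section
/- Let V be a real vector space with a complex structure J (a linear map with J² = −1), let F ⊂ V be a J-invariant linear subspace, and let B : V → V be a real-linear map satisfying B(F) = 0, Im B ⊆ F, and B(Jξ) = −J B(ξ) for all ξ. Then the linear map J₀ := J − ½ J∘B satisfies J₀² = −1, i.e. J₀ is again a complex structure on V, and J = J₀ + ½ J₀∘B. -/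
/-!
STATEMENT 8.  Pointwise algebraic core of the decomposition `J = J₀ + ½J₀∘B` for linear
bundle almost complex structures: if `J` is a complex structure on a real vector space `V`,
`F` a `J`-invariant subspace and `B : V → V` a real-linear map with `B(F)=0`, `Im B ⊆ F`
and `B∘J = −J∘B`, then `J₀ := J − ½ J∘B` is again a complex structure and
`J = J₀ + ½ J₀∘B`.
-/

theorem statement8 {V : Type*} [AddCommGroup V] [Module ℝ V]
    (J B : V →ₗ[ℝ] V) (F : Submodule ℝ V)
    (hJ2 : J ∘ₗ J = - LinearMap.id)
    (hJF : ∀ v ∈ F, J v ∈ F)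
    (hBF : ∀ v ∈ F, B v = 0)
    (hBim : ∀ v : V, B v ∈ F)
    (hanti : ∀ v : V, B (J v) = - J (B v)) :
    ((J - (2⁻¹ : ℝ) • (J ∘ₗ B)) ∘ₗ (J - (2⁻¹ : ℝ) • (J ∘ₗ B)) = - LinearMap.id) ∧
    J = (J - (2⁻¹ : ℝ) • (J ∘ₗ B)) + (2⁻¹ : ℝ) • ((J - (2⁻¹ : ℝ) • (J ∘ₗ B)) ∘ₗ B) := by
  have hJJ (v : V) : J (J v) = -v := by simpa using LinearMap.congr_fun hJ2 v
  have hBB (v : V) : B (B v) = 0 := hBF _ (hBim v)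
  constructor <;> ext v <;> simp [hJJ, hBB, hanti]
end
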